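/- Let π_θ and π_ref be two causal language models over a finite nonempty vocabulary V with horizon T ≥ 1, and let β > 0. Define r(y) = β·log(π_θ(y)/π_ref(y)) for full sequences y ∈ V^T and q^t(y_{≤t}) = Σ_{i=1}^t β·log(π_θ(y_i | y_{<i})/π_ref(y_i | y_{<i})) for 0 ≤ t ≤ T. Then for every 0 ≤ t ≤ T and every prefix y_{≤t} ∈ V^t, the soft and hard MCTS estimates bound q^t: Σ_{y ∈ V^T extending y_{≤t}} π_ref(y | y_{≤t}) · r(y) ≤ q^t(y_{≤t}) ≤ max_{y ∈ V^T extending y_{≤t}} r(y). -/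

import Mathlib

open Finset Real

/-- A causal language model over vocabulary `V` with horizon `T`:
for each position `i` and prefix of length `i`, a strictly positive
conditional distribution over the next token. -/
structure CausalLM (V : Type) [Fintype V] (T : ℕ) where
  cond : ∀ i : Fin T, (Fin i → V) → V → ℝ
  cond_pos : ∀ i p v, 0 < cond i p v
  cond_sum_one : ∀ i p, ∑ v, cond i p v = 1

variable {V : Type} [Fintype V] [DecidableEq V] [Nonempty V] {T : ℕ}

/-- The prefix `y_{<i}` of a full sequence `y`. -/
def pref (y : Fin T → V) (i : Fin T) : Fin i → V :=
  fun j => y ⟨j, j.isLt.trans i.isLt⟩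

/-- `π(y) = ∏_{i=1}^T π(y_i | y_{<i})`. -/
noncomputable def fullProb (lm : CausalLM V T) (y : Fin T → V) : ℝ :=
  ∏ i, lm.cond i (pref y i) (y i)

/-- `π(y | y_{≤t}) = ∏_{i=t+1}^T π(y_i | y_{<i})`. -/
noncomputable def condProbFrom (lm : CausalLM V T) (t : ℕ) (y : Fin T → V) : ℝ :=
  ∏ i ∈ Finset.univ.filter (fun i : Fin T => t ≤ i.val), lm.cond i (pref y i) (y i)

/-- The full sequences `y ∈ V^T` extending the prefix `p ∈ V^t`. -/
def completions (t : ℕ) (ht : t ≤ T) (p : Fin t → V) : Finset (Fin T → V) :=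
  Finset.univ.filter (fun y => ∀ j : Fin t, y ⟨j, lt_of_lt_of_le j.isLt ht⟩ = p j)

lemma completions_nonempty (t : ℕ) (ht : t ≤ T) (p : Fin t → V) :
    (completions t ht p).Nonempty := by
  refine ⟨fun i => if h : i.val < t then p ⟨i, h⟩ else Classical.arbitrary V, ?_⟩
  simp only [completions, Finset.mem_filter, Finset.mem_univ, true_and]
  intro j
  simp [j.isLt]

/-- `r(y) = β log (π_θ(y) / π_ref(y))`. -/
noncomputable def rval (lmθ lmRef : CausalLM V T) (β : ℝ) (y : Fin T → V) : ℝ :=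
  β * Real.log (fullProb lmθ y / fullProb lmRef y)

/-- `q^t(y_{≤t}) = ∑_{i=1}^t β log (π_θ(y_i|y_{<i}) / π_ref(y_i|y_{<i}))`. -/
noncomputable def qval (lmθ lmRef : CausalLM V T) (β : ℝ) (t : ℕ) (ht : t ≤ T)
    (p : Fin t → V) : ℝ :=
  ∑ i : Fin t,
    β * Real.log
      (lmθ.cond ⟨i, lt_of_lt_of_le i.isLt ht⟩ (fun j => p ⟨j, j.isLt.trans i.isLt⟩) (p i) /
       lmRef.cond ⟨i, lt_of_lt_of_le i.isLt ht⟩ (fun j => p ⟨j, j.isLt.trans i.isLt⟩) (p i))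

set_option linter.unusedSectionVars false

lemma mem_completions {t : ℕ} {ht : t ≤ T} {p : Fin t → V} {y : Fin T → V} :
    y ∈ completions t ht p ↔ ∀ j : Fin t, y ⟨j, j.isLt.trans_le ht⟩ = p j := by
  simp [completions]

lemma condProbFrom_pos (lm : CausalLM V T) (t : ℕ) (y : Fin T → V) :
    0 < condProbFrom lm t y :=
  Finset.prod_pos fun _ _ => lm.cond_pos _ _ _

lemma condProbFrom_of_lt (lm : CausalLM V T) {t : ℕ} (ht : t < T) (y : Fin T → V) :
    condProbFrom lm t y =
      lm.cond ⟨t, ht⟩ (pref y ⟨t, ht⟩) (y ⟨t, ht⟩) * condProbFrom lm (t + 1) y := by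
  have h : Finset.univ.filter (fun i : Fin T => t ≤ i.val) =
      insert ⟨t, ht⟩ (Finset.univ.filter (fun i : Fin T => t + 1 ≤ i.val)) := by
    ext i
    simp only [Finset.mem_filter, Finset.mem_univ, true_and, Finset.mem_insert, Fin.ext_iff]
    omega
  rw [condProbFrom, h, Finset.prod_insert (by simp), condProbFrom]

lemma filter_completions_eq {t : ℕ} (ht : t < T) (p : Fin t → V) (v : V) :
    (completions t ht.le p).filter (fun y => y ⟨t, ht⟩ = v) =
      completions (t + 1) ht (Fin.snoc (α := fun _ => V) p v) := by
  ext y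
  simp [mem_completions, Fin.forall_fin_succ']

lemma pref_eq_of_mem_completions {t : ℕ} (ht : t < T) {p : Fin t → V} {y : Fin T → V}
    (hy : y ∈ completions t ht.le p) : pref y ⟨t, ht⟩ = p :=
  funext fun j => mem_completions.1 hy j

/-- The conditional probabilities of the completions of a prefix sum to one. -/
lemma sum_condProbFrom_completions (lm : CausalLM V T) (t : ℕ) (ht : t ≤ T) (p : Fin t → V) :
    ∑ y ∈ completions t ht p, condProbFrom lm t y = 1 := by
  obtain ⟨k, hk⟩ : ∃ k, T = t + k := Nat.exists_eq_add_of_le ht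
  induction k generalizing t with
  | zero =>
    obtain rfl : T = t := hk
    have h : completions T ht p = {p} := by
      ext y
      simp [mem_completions, funext_iff]
    have hT : Finset.univ.filter (fun i : Fin T => T ≤ i.val) = ∅ := by
      ext i
      simp
    simp [h, condProbFrom, hT]
  | succ k ih =>
    have htT : t < T := by omega
    rw [← Finset.sum_fiberwise (completions t ht p) (fun y => y ⟨t, htT⟩),
      ← lm.cond_sum_one ⟨t, htT⟩ p]
    refine Finset.sum_congr rfl fun v _ => ?_
    calc
      _ = ∑ y ∈ (completions t ht p).filter (fun y => y ⟨t, htT⟩ = v),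
            lm.cond ⟨t, htT⟩ p v * condProbFrom lm (t + 1) y := by
        refine Finset.sum_congr rfl fun y hy => ?_
        obtain ⟨hy', rfl⟩ := Finset.mem_filter.1 hy
        rw [condProbFrom_of_lt lm htT, pref_eq_of_mem_completions htT hy']
      _ = _ := by
        rw [filter_completions_eq, ← Finset.mul_sum, ih (t + 1) htT _ (by omega), mul_one]

/-- Chain rule: the probability of a completion factors through the prefix. -/
lemma fullProb_eq_prod_mul_condProbFrom (lm : CausalLM V T) {t : ℕ} (ht : t ≤ T)
    {p : Fin t → V} {y : Fin T → V} (hy : y ∈ completions t ht p) :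
    fullProb lm y =
      (∏ i : Fin t, lm.cond ⟨i, i.isLt.trans_le ht⟩ (fun j => p ⟨j, j.isLt.trans i.isLt⟩) (p i)) *
        condProbFrom lm t y := by
  rw [fullProb, ← Finset.prod_filter_not_mul_prod_filter _ (fun i : Fin T => t ≤ i.val),
    condProbFrom]
  congr 1
  symm
  refine Finset.prod_bij (fun i _ => Fin.castLE ht i) (by simp) (by simp) ?_ ?_
  · intro i hi
    simp only [Finset.mem_filter, Finset.mem_univ, true_and, not_le] at hi
    exact ⟨⟨i, hi⟩, Finset.mem_univ _, rfl⟩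
  · intro i _
    have h := mem_completions.1 hy
    have hp : pref y (Fin.castLE ht i) = fun j : Fin i => p ⟨j, j.isLt.trans i.isLt⟩ :=
      funext fun j : Fin i => h ⟨j, j.isLt.trans i.isLt⟩
    rw [hp]
    exact congrArg _ (h i).symm

lemma rval_eq_qval_add (lmθ lmRef : CausalLM V T) (β : ℝ) {t : ℕ} (ht : t ≤ T)
    {p : Fin t → V} {y : Fin T → V} (hy : y ∈ completions t ht p) :
    rval lmθ lmRef β y = qval lmθ lmRef β t ht p +
      β * Real.log (condProbFrom lmθ t y / condProbFrom lmRef t y) := by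
  rw [rval, fullProb_eq_prod_mul_condProbFrom lmθ ht hy,
    fullProb_eq_prod_mul_condProbFrom lmRef ht hy, mul_div_mul_comm, ← Finset.prod_div_distrib,
    Real.log_mul, Real.log_prod, mul_add, Finset.mul_sum, qval]
  · exact fun i _ => (div_pos (lmθ.cond_pos _ _ _) (lmRef.cond_pos _ _ _)).ne'
  · exact (Finset.prod_pos fun i _ =>
      div_pos (lmθ.cond_pos _ _ _) (lmRef.cond_pos _ _ _)).ne'
  · exact (div_pos (condProbFrom_pos _ _ _) (condProbFrom_pos _ _ _)).ne'

/-- Gibbs' inequality for positive weights of equal total mass. -/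
lemma sum_mul_log_div_nonpos {ι : Type*} (s : Finset ι) (a b : ι → ℝ) (ha : ∀ i ∈ s, 0 < a i)
    (hb : ∀ i ∈ s, 0 < b i) (hab : ∑ i ∈ s, a i = ∑ i ∈ s, b i) :
    ∑ i ∈ s, b i * Real.log (a i / b i) ≤ 0 := by
  calc
    _ ≤ ∑ i ∈ s, (a i - b i) := by
      refine Finset.sum_le_sum fun i hi => ?_
      have h := mul_le_mul_of_nonneg_left
        (Real.log_le_sub_one_of_pos (div_pos (ha i hi) (hb i hi))) (hb i hi).le
      rwa [mul_sub, mul_div_cancel₀ _ (hb i hi).ne', mul_one] at h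
    _ = 0 := by rw [Finset.sum_sub_distrib, hab, sub_self]

/-- **Proposition 2 (inequalities).** `q^t` lies between the soft-estimated Q
value (the expectation of `r` over completions under `π_ref`) and the
hard-estimated Q value (the maximum of `r` over completions). -/
theorem prop2_q_between_soft_and_hard
    (V : Type) [Fintype V] [DecidableEq V] [Nonempty V]
    (T : ℕ) (hT : 1 ≤ T) (lmθ lmRef : CausalLM V T) (β : ℝ) (hβ : 0 < β)
    (t : ℕ) (ht : t ≤ T) (p : Fin t → V) :
    (∑ y ∈ completions t ht p, condProbFrom lmRef t y * rval lmθ lmRef β y)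
        ≤ qval lmθ lmRef β t ht p
    ∧ qval lmθ lmRef β t ht p
        ≤ (completions t ht p).sup' (completions_nonempty t ht p) (rval lmθ lmRef β) := by
  have hθ := sum_condProbFrom_completions lmθ t ht p
  have hRef := sum_condProbFrom_completions lmRef t ht p
  constructor
  · have hgibbs := sum_mul_log_div_nonpos (completions t ht p) (condProbFrom lmθ t)
      (condProbFrom lmRef t) (fun _ _ => condProbFrom_pos _ _ _)
      (fun _ _ => condProbFrom_pos _ _ _) (hθ.trans hRef.symm)
    calc
      _ = ∑ y ∈ completions t ht p, (condProbFrom lmRef t y * qval lmθ lmRef β t ht p +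
            β * (condProbFrom lmRef t y *
              Real.log (condProbFrom lmθ t y / condProbFrom lmRef t y))) := by
        refine Finset.sum_congr rfl fun y hy => ?_
        rw [rval_eq_qval_add lmθ lmRef β ht hy]
        ring
      _ = qval lmθ lmRef β t ht p + β * ∑ y ∈ completions t ht p, condProbFrom lmRef t y *
            Real.log (condProbFrom lmθ t y / condProbFrom lmRef t y) := by
        rw [Finset.sum_add_distrib, ← Finset.sum_mul, hRef, one_mul, Finset.mul_sum]
      _ ≤ _ := add_le_of_nonpos_right (mul_nonpos_of_nonneg_of_nonpos hβ.le hgibbs)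
  · obtain ⟨y, hy, hle⟩ := Finset.exists_le_of_sum_le (completions_nonempty t ht p)
      (hRef.trans hθ.symm).le
    refine le_trans ?_ (Finset.le_sup' _ hy)
    rw [rval_eq_qval_add lmθ lmRef β ht hy]
    exact le_add_of_nonneg_right (mul_nonneg hβ.le
      (Real.log_nonneg ((one_le_div (condProbFrom_pos _ _ _)).2 hle)))
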